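/- arXiv:2112.13106 — 3 statements merged into one kernel-verified Lean document; each statement's English description precedes it below -/
import Mathlib

section
/- Let (X, 𝓤) be a uniform space and suppose X = ⋃_{n ∈ ℕ} X_n. Then (X, 𝓤) is Hurewicz-bounded if and only if for each n ∈ ℕ the subspace X_n (with the relative uniformity) is Hurewicz-bounded. -/
open UniformSpace Set Filter Uniformity

def HurewiczBounded (X : Type*) [UniformSpace X] : Prop :=
  ∀ U : ℕ → Set (X × X), (∀ n, U n ∈ 𝓤 X) →
    ∃ F : ℕ → Finset X, ∀ x : X,
      ∀ᶠ n in Filter.atTop, ∃ y ∈ F n, x ∈ UniformSpace.ball y (U n)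

/-- Hurewicz-boundedness is inherited by arbitrary subspaces. -/
theorem HurewiczBounded.subtype {X : Type*} [UniformSpace X] (h : HurewiczBounded X)
    (S : Set X) : HurewiczBounded S := by
  classical
  intro U hU
  rcases isEmpty_or_nonempty S with hS | ⟨⟨s₀⟩⟩
  · exact ⟨fun _ => ∅, fun x => isEmptyElim x⟩
  have hW : ∀ n, ∃ W ∈ 𝓤 X, ∀ (y : X) (s t : S),
      (y, (s : X)) ∈ W → (y, (t : X)) ∈ W → (s, t) ∈ U n := by
    intro n
    have hn := hU n
    rw [uniformity_subtype, mem_comap] at hn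
    obtain ⟨V, hV, hVU⟩ := hn
    obtain ⟨W, hW, hsymm, hWV⟩ := comp_symm_mem_uniformity_sets hV
    refine ⟨W, hW, fun y s t hs ht => hVU (hWV ?_)⟩
    exact ⟨y, hsymm.symm _ _ hs, ht⟩
  choose W hW hWU using hW
  obtain ⟨F, hF⟩ := h W hW
  have hg : ∀ n (y : X), ∃ s : S, ∀ t : S, (y, (t : X)) ∈ W n → (y, (s : X)) ∈ W n := by
    intro n y
    by_cases hy : ∃ s : S, (y, (s : X)) ∈ W n
    · obtain ⟨s, hs⟩ := hy
      exact ⟨s, fun _ _ => hs⟩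
    · exact ⟨s₀, fun t ht => (hy ⟨t, ht⟩).elim⟩
  choose g hg using hg
  refine ⟨fun n => (F n).image (g n), fun x => ?_⟩
  filter_upwards [hF x] with n ⟨y, hy, hxy⟩
  exact ⟨g n y, Finset.mem_image_of_mem _ hy, hWU n y _ _ (hg n y x hxy) hxy⟩

/-- A countable union of Hurewicz-bounded subspaces is Hurewicz-bounded. -/
theorem HurewiczBounded.of_iUnion_eq_univ {X : Type*} [UniformSpace X] {S : ℕ → Set X}
    (hS : (⋃ n, S n) = Set.univ) (h : ∀ n, HurewiczBounded (S n)) : HurewiczBounded X := by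
  classical
  intro U hU
  have hF : ∀ k, ∃ F : ℕ → Finset (S k), ∀ x : S k,
      ∀ᶠ n in atTop, ∃ y ∈ F n, ((y : X), (x : X)) ∈ U n := fun k =>
    h k (fun n => (fun p : S k × S k => ((p.1 : X), (p.2 : X))) ⁻¹' U n) fun n => by
      rw [uniformity_subtype]
      exact preimage_mem_comap (hU n)
  choose F hF using hF
  refine ⟨fun n => (Finset.range (n + 1)).biUnion fun k => (F k n).image Subtype.val,
    fun x => ?_⟩
  obtain ⟨k, hk⟩ := mem_iUnion.mp (hS ▸ mem_univ x)
  filter_upwards [hF k ⟨x, hk⟩, eventually_ge_atTop k] with n ⟨y, hy, hxy⟩ hkn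
  exact ⟨y, Finset.mem_biUnion.mpr
    ⟨k, Finset.mem_range.mpr (Nat.lt_succ_of_le hkn), Finset.mem_image_of_mem _ hy⟩, hxy⟩

theorem stmt_1 {X : Type*} [UniformSpace X] (Xn : ℕ → Set X)
    (hX : (⋃ n, Xn n) = Set.univ) :
    HurewiczBounded X ↔ ∀ n : ℕ, HurewiczBounded ↥(Xn n) :=
  ⟨fun h n => h.subtype (Xn n), HurewiczBounded.of_iUnion_eq_univ hX⟩
end

section
/- Let (X, 𝓤) be a uniform space. If X (with the topology induced by 𝓤) is locally Menger, then (X, 𝓤) is locally Menger-bounded. -/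
open UniformSpace Set Filter Uniformity

def MengerBounded (X : Type*) [UniformSpace X] : Prop :=
  ∀ U : ℕ → Set (X × X), (∀ n, U n ∈ 𝓤 X) →
    ∃ F : ℕ → Finset X, ∀ x : X, ∃ n : ℕ, ∃ y ∈ F n, x ∈ UniformSpace.ball y (U n)

def LocallyMengerBounded (X : Type*) [UniformSpace X] : Prop :=
  ∀ x : X, ∃ U ∈ 𝓤 X, MengerBounded ↥(UniformSpace.ball x U)

def MengerSpace (X : Type*) [TopologicalSpace X] : Prop :=
  ∀ 𝒰 : ℕ → Set (Set X), (∀ n, (∀ U ∈ 𝒰 n, IsOpen U) ∧ ⋃₀ 𝒰 n = Set.univ) →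
    ∃ 𝒱 : ℕ → Set (Set X), (∀ n, 𝒱 n ⊆ 𝒰 n ∧ (𝒱 n).Finite) ∧
      (⋃ n, ⋃₀ 𝒱 n) = Set.univ

def LocallyMenger (X : Type*) [TopologicalSpace X] : Prop :=
  ∀ x : X, ∃ U : Set X, ∃ Y : Set X, IsOpen U ∧ MengerSpace ↥Y ∧ x ∈ U ∧ U ⊆ Y

theorem MengerSpace.mengerBounded {X : Type*} [UniformSpace X] (h : MengerSpace X) :
    MengerBounded X := by
  classical
  intro U hU
  obtain ⟨𝒱, h𝒱, hcov⟩ := h (fun n => range fun y => interior (ball y (U n))) fun n => by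
    refine ⟨by rintro _ ⟨y, rfl⟩; exact isOpen_interior, eq_univ_of_forall fun x => ?_⟩
    exact ⟨_, ⟨x, rfl⟩, mem_interior_iff_mem_nhds.2 (ball_mem_nhds x (hU n))⟩
  have hF : ∀ n, ∃ F : Finset X, ∀ s ∈ 𝒱 n, ∃ y ∈ F, interior (ball y (U n)) = s := fun n => by
    obtain ⟨t, ht⟩ := (h𝒱 n).2.exists_finset_coe
    have hsub := (h𝒱 n).1
    rw [← image_univ, ← ht, Finset.subset_set_image_iff] at hsub
    obtain ⟨F, -, rfl⟩ := hsub
    refine ⟨F, fun s hs => ?_⟩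
    rw [← ht] at hs
    simpa using hs
  choose F hF using hF
  refine ⟨F, fun x => ?_⟩
  obtain ⟨n, s, hs, hx⟩ := mem_iUnion.1 (hcov ▸ mem_univ x)
  obtain ⟨y, hy, rfl⟩ := hF n s hs
  exact ⟨n, y, hy, interior_subset hx⟩

theorem MengerBounded.of_isUniformInducing {X Y : Type*} [UniformSpace X] [UniformSpace Y]
    {f : X → Y} (hf : IsUniformInducing f) (h : MengerBounded Y) : MengerBounded X := by
  classical
  intro U hU
  cases isEmpty_or_nonempty X
  · exact ⟨fun _ => ∅, fun x => isEmptyElim x⟩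
  have hW : ∀ n, ∃ W ∈ 𝓤 Y, ∀ y a b, f a ∈ ball y W → f b ∈ ball y W → (a, b) ∈ U n := by
    intro n
    have hn := hU n
    rw [← hf.comap_uniformity] at hn
    obtain ⟨V, hV, hVU⟩ := hn
    obtain ⟨W, hW, hsymm, hWV⟩ := comp_symm_mem_uniformity_sets hV
    exact ⟨W, hW, fun y a b ha hb => hVU (hWV ⟨y, hsymm.symm _ _ ha, hb⟩)⟩
  choose W hW hWU using hW
  obtain ⟨F, hF⟩ := h W hW
  have hg : ∀ n y, ∃ b, ∀ a, f a ∈ ball y (W n) → f b ∈ ball y (W n) := fun n y => by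
    by_cases hy : ∃ b, f b ∈ ball y (W n)
    · exact hy.imp fun b hb _ _ => hb
    · exact ⟨Classical.arbitrary X, fun a ha => (hy ⟨a, ha⟩).elim⟩
  choose g hg using hg
  refine ⟨fun n => (F n).image (g n), fun x => ?_⟩
  obtain ⟨n, y, hy, hx⟩ := hF (f x)
  exact ⟨n, g n y, Finset.mem_image_of_mem _ hy, hWU n y _ _ (hg n y x hx) hx⟩

theorem MengerBounded.mono {X : Type*} [UniformSpace X] {s t : Set X} (hst : s ⊆ t)
    (h : MengerBounded ↥t) : MengerBounded ↥s :=
  h.of_isUniformInducing (isUniformEmbedding_set_inclusion hst).isUniformInducing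

theorem stmt_11 {X : Type*} [UniformSpace X] (h : LocallyMenger X) :
    LocallyMengerBounded X := by
  intro x
  obtain ⟨U, Y, hU, hY, hxU, hUY⟩ := h x
  obtain ⟨V, hV, hVU⟩ := UniformSpace.mem_nhds_iff.1 (hU.mem_nhds hxU)
  exact ⟨V, hV, hY.mengerBounded.mono (hVU.trans hUY)⟩
end

section
/- Let {X_α : α ∈ Λ} be a locally finite family of closed subspaces of a uniform space (X, 𝓤) with X = ⋃_{α ∈ Λ} X_α. Then (X, 𝓤) is locally Menger-bounded if and only if each X_α (with the relative uniformity) is locally Menger-bounded. -/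
open UniformSpace Set Filter Uniformity

open Topology

/-- A subset `S` of `X` is Menger-bounded with centers allowed anywhere in `X`. -/
def MengerBoundedIn {X : Type*} [UniformSpace X] (S : Set X) : Prop :=
  ∀ U : ℕ → Set (X × X), (∀ n, U n ∈ 𝓤 X) →
    ∃ F : ℕ → Finset X, ∀ x ∈ S, ∃ n : ℕ, ∃ y ∈ F n, x ∈ UniformSpace.ball y (U n)

theorem MengerBoundedIn.mono {X : Type*} [UniformSpace X] {S T : Set X}
    (hT : MengerBoundedIn T) (h : S ⊆ T) : MengerBoundedIn S := fun U hU =>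
  let ⟨F, hF⟩ := hT U hU
  ⟨F, fun x hx => hF x (h hx)⟩

theorem MengerBoundedIn.biUnion {X ι : Type*} [UniformSpace X] {I : Set ι} (hI : I.Finite)
    {S : ι → Set X} (hS : ∀ i ∈ I, MengerBoundedIn (S i)) : MengerBoundedIn (⋃ i ∈ I, S i) := by
  classical
  intro U hU
  choose! F hF using fun i hi => hS i hi U hU
  refine ⟨fun n => hI.toFinset.biUnion fun i => F i n, fun x hx => ?_⟩
  obtain ⟨i, hi, hx⟩ := mem_iUnion₂.1 hx
  obtain ⟨n, y, hy, hxy⟩ := hF i hi x hx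
  exact ⟨n, y, Finset.mem_biUnion.2 ⟨i, hI.mem_toFinset.2 hi, hy⟩, hxy⟩

theorem IsUniformInducing.mengerBounded_iff {X Y : Type*} [UniformSpace X] [UniformSpace Y]
    {f : Y → X} (hf : IsUniformInducing f) :
    MengerBounded Y ↔ MengerBoundedIn (range f) := by
  classical
  constructor
  · intro h U hU
    obtain ⟨F, hF⟩ := h (fun n => Prod.map f f ⁻¹' U n) fun n => hf.uniformContinuous (hU n)
    refine ⟨fun n => (F n).image f, ?_⟩
    rintro _ ⟨x, rfl⟩
    obtain ⟨n, y, hy, hxy⟩ := hF x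
    exact ⟨n, f y, Finset.mem_image_of_mem f hy, hxy⟩
  · intro h U hU
    have hW : ∀ n, ∃ W ∈ 𝓤 X, ∀ a b c, (c, a) ∈ W → (c, b) ∈ W → ∀ a' b', f a' = a → f b' = b →
        (a', b') ∈ U n := by
      intro n
      have hn := hU n
      rw [← hf.comap_uniformity] at hn
      obtain ⟨V, hV, hVU⟩ := mem_comap.1 hn
      obtain ⟨W, hW, hsymm, hWV⟩ := comp_symm_mem_uniformity_sets hV
      refine ⟨W, hW, ?_⟩
      rintro _ _ c ha hb a b rfl rfl
      exact hVU (hWV ⟨c, hsymm.symm _ _ ha, hb⟩)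
    choose W hW hWU using hW
    obtain ⟨F, hF⟩ := h W hW
    rcases isEmpty_or_nonempty Y with hY | ⟨⟨y₀⟩⟩
    · exact ⟨fun _ => ∅, fun x => isEmptyElim x⟩
    have hg : ∀ n c, ∃ y : Y, ∀ z, (c, f z) ∈ W n → (c, f y) ∈ W n := by
      intro n c
      by_cases hc : ∃ z, (c, f z) ∈ W n
      · exact hc.imp fun y hy _ _ => hy
      · exact ⟨y₀, fun z hz => (hc ⟨z, hz⟩).elim⟩
    choose g hg using hg
    refine ⟨fun n => (F n).image (g n), fun x => ?_⟩
    obtain ⟨n, c, hc, hx⟩ := hF (f x) ⟨x, rfl⟩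
    exact ⟨n, g n c, Finset.mem_image_of_mem _ hc, hWU n _ _ c (hg n c x hx) hx _ _ rfl rfl⟩

theorem IsUniformInducing.locallyMengerBounded_iff {X Y : Type*} [UniformSpace X] [UniformSpace Y]
    {f : Y → X} (hf : IsUniformInducing f) :
    LocallyMengerBounded Y ↔ ∀ y, ∃ s ∈ 𝓝 (f y), MengerBoundedIn (s ∩ range f) := by
  have key (y : Y) (U : Set (Y × Y)) : MengerBounded ↥(UniformSpace.ball y U) ↔
      MengerBoundedIn (f '' UniformSpace.ball y U) := by
    rw [(hf.comp (isUniformInducing_val (UniformSpace.ball y U))).mengerBounded_iff, range_comp,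
      Subtype.range_coe]
  refine forall_congr' fun y => ?_
  simp only [key]
  constructor
  · rintro ⟨U, hU, h⟩
    have hy := UniformSpace.ball_mem_nhds y hU
    rw [hf.isInducing.nhds_eq_comap] at hy
    obtain ⟨s, hs, hsU⟩ := mem_comap.1 hy
    refine ⟨s, hs, h.mono ?_⟩
    rintro _ ⟨hz, z, rfl⟩
    exact ⟨z, hsU hz, rfl⟩
  · rintro ⟨s, hs, h⟩
    obtain ⟨U, hU, hUs⟩ := UniformSpace.mem_nhds_iff.1 (hf.isInducing.continuous.continuousAt hs)
    refine ⟨U, hU, h.mono ?_⟩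
    rintro _ ⟨z, hz, rfl⟩
    exact ⟨hUs hz, z, rfl⟩

theorem stmt_18 {X : Type*} [UniformSpace X] {Λ : Type*} (Xa : Λ → Set X)
    (hclosed : ∀ α, IsClosed (Xa α)) (hlf : LocallyFinite Xa)
    (hX : (⋃ α, Xa α) = Set.univ) :
    LocallyMengerBounded X ↔ ∀ α, LocallyMengerBounded ↥(Xa α) := by
  simp only [(IsUniformInducing.id (α := X)).locallyMengerBounded_iff,
    (isUniformInducing_val (Xa _)).locallyMengerBounded_iff, range_id, inter_univ,
    Subtype.range_coe, id]
  constructor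
  · intro h α x
    obtain ⟨s, hs, hb⟩ := h x
    exact ⟨s, hs, hb.mono inter_subset_left⟩
  · intro h x
    have hI : {α | x ∈ Xa α}.Finite := hlf.point_finite x
    choose! s hs hb using fun α (hα : α ∈ {α | x ∈ Xa α}) => h α ⟨x, hα⟩
    refine ⟨_, inter_mem ((biInter_mem hI).2 hs) (hlf.iInter_compl_mem_nhds hclosed x),
      (MengerBoundedIn.biUnion hI hb).mono ?_⟩
    rintro z ⟨hzs, hz⟩
    obtain ⟨α, hα⟩ := mem_iUnion.1 (hX.ge (mem_univ z))
    have hxα : x ∈ Xa α := by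
      by_contra hx
      exact mem_iInter₂.1 hz α hx hα
    exact mem_iUnion₂.2 ⟨α, hxα, mem_iInter₂.1 hzs α hxα, hα⟩
end
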